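/- arXiv:1610.09503 — 5 statements merged into one kernel-verified Lean document; each statement's English description precedes it below -/
import Mathlib

section
/- Perfect honest-verifier zero-knowledge of the homomorphism proof of knowledge: Let G be a finite group, H a group, f : G →* H a group homomorphism, s ∈ G and b a natural number. The distribution of the honest prover's transcript components (t₁, z) = (f(s'), s' * s^b), when s' is drawn uniformly at random from G, is exactly equal to the distribution of the simulated transcript (f(z) * (f(s)^b)⁻¹, z), when z is drawn uniformly at random from G. Formally, PMF.map (fun s' => (f s', s' * s^b)) of the uniform distribution on G equals PMF.map (fun z => (f z * (f s ^ b)⁻¹, z)) of the uniform distribution on G. -/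
/-- An equivalence of finite types carries the uniform distribution to the uniform distribution. -/
theorem PMF.map_equiv_uniformOfFintype {α β : Type*} [Fintype α] [Nonempty α] [Fintype β]
    [Nonempty β] (e : α ≃ β) :
    PMF.map e (PMF.uniformOfFintype α) = PMF.uniformOfFintype β := by
  ext y
  rw [PMF.map_apply, tsum_eq_single (e.symm y)]
  · simp [Fintype.card_congr e]
  · intro x hx
    exact if_neg fun h => hx (e.eq_symm_apply.mpr h.symm)


/-- Perfect honest-verifier zero-knowledge of the homomorphism proof of knowledge:
the real transcript `(f s', s' * s ^ b)` with `s'` uniform on `G` has exactly the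
same distribution as the simulated transcript `(f z * (f s ^ b)⁻¹, z)` with `z`
uniform on `G`. -/
theorem perfect_hvzk_homomorphism_pok
    {G H : Type*} [Group G] [Fintype G] [Nonempty G] [Group H]
    (f : G →* H) (s : G) (b : ℕ) :
    PMF.map (fun s' => (f s', s' * s ^ b)) (PMF.uniformOfFintype G) =
      PMF.map (fun z => (f z * (f s ^ b)⁻¹, z)) (PMF.uniformOfFintype G) := by
  conv_rhs => rw [← PMF.map_equiv_uniformOfFintype (Equiv.mulRight (s ^ b)), PMF.map_comp]
  congr 1
  ext x <;> simp
end

section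
/- Knowledge extraction for the protocol with enlarged challenge space (Section 'Reducing the soundness error'): Let G be a group, H a commutative group, f : G →* H a group homomorphism, I, t ∈ H, u ∈ G and ℓ ∈ ℤ with f(u) = I^ℓ. Suppose z₁, z₂ ∈ G and b₁, b₂ ∈ ℤ satisfy the verification equations f(z₁) = t * I^{b₁} and f(z₂) = t * I^{b₂} (two accepting transcripts with the same commitment t and different challenges), and that x, y ∈ ℤ satisfy the Bézout identity x·ℓ + y·(b₂ − b₁) = 1. Then f(u^x * (z₁⁻¹ * z₂)^y) = I, i.e. u^x * (z₁⁻¹ * z₂)^y is a preimage of I under f. -/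
/-- Knowledge extraction for the protocol with enlarged challenge space:
given `f u = I ^ ℓ`, two accepting transcripts `f z₁ = t * I ^ b₁`,
`f z₂ = t * I ^ b₂`, and a Bézout identity `x * ℓ + y * (b₂ - b₁) = 1`,
the value `u ^ x * (z₁⁻¹ * z₂) ^ y` is a preimage of `I` under `f`. -/
theorem knowledge_extraction_enlarged_challenge
    {G H : Type*} [Group G] [CommGroup H] (f : G →* H) (I t : H) (u : G) (ℓ : ℤ)
    (hu : f u = I ^ ℓ)
    (z₁ z₂ : G) (b₁ b₂ : ℤ)
    (h₁ : f z₁ = t * I ^ b₁) (h₂ : f z₂ = t * I ^ b₂)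
    (x y : ℤ) (hbezout : x * ℓ + y * (b₂ - b₁) = 1) :
    f (u ^ x * (z₁⁻¹ * z₂) ^ y) = I := by
  have hz : f (z₁⁻¹ * z₂) = I ^ (b₂ - b₁) := by
    rw [map_mul, map_inv, h₁, h₂, mul_inv, mul_mul_mul_comm, inv_mul_cancel, one_mul,
      zpow_sub, mul_comm]
  rw [map_mul, map_zpow, map_zpow, hu, hz, ← zpow_mul, ← zpow_mul, ← zpow_add,
    mul_comm ℓ x, mul_comm (b₂ - b₁) y, hbezout, zpow_one]
end

section
/- Existence form of the knowledge extractor for the enlarged challenge space: Let G be a group, H a commutative group, f : G →* H a group homomorphism and I ∈ H. Suppose there exist u ∈ G and ℓ ∈ ℤ with f(u) = I^ℓ, and there exist t ∈ H, z₁, z₂ ∈ G and integers b₁, b₂ with f(z₁) = t * I^{b₁}, f(z₂) = t * I^{b₂}, such that ℓ and b₂ − b₁ are coprime in ℤ (IsCoprime ℓ (b₂ − b₁)). Then there exists s ∈ G with f(s) = I. -/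
/-- Existence form of the knowledge extractor for the enlarged challenge space:
if `f u = I ^ ℓ` for some `u, ℓ`, and there are two accepting transcripts with the
same commitment `t` whose challenges `b₁, b₂` satisfy `IsCoprime ℓ (b₂ - b₁)`,
then `I` has a preimage under `f`. -/
theorem exists_preimage_enlarged_challenge
    {G H : Type*} [Group G] [CommGroup H] (f : G →* H) (I : H)
    (h : ∃ (u : G) (ℓ : ℤ) (t : H) (z₁ z₂ : G) (b₁ b₂ : ℤ),
      f u = I ^ ℓ ∧ f z₁ = t * I ^ b₁ ∧ f z₂ = t * I ^ b₂ ∧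
      IsCoprime ℓ (b₂ - b₁)) :
    ∃ s : G, f s = I := by
  obtain ⟨u, ℓ, t, z₁, z₂, b₁, b₂, hu, h₁, h₂, a, b, hab⟩ := h
  have hz : f (z₁⁻¹ * z₂) = I ^ (b₂ - b₁) := by
    rw [map_mul, map_inv, h₁, h₂, zpow_sub, mul_inv, mul_mul_mul_comm, inv_mul_cancel, one_mul,
      mul_comm]
  refine ⟨u ^ a * (z₁⁻¹ * z₂) ^ b, ?_⟩
  rw [map_mul, map_zpow, map_zpow, hu, hz, ← zpow_mul, ← zpow_mul, ← zpow_add,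
    mul_comm ℓ, mul_comm (b₂ - b₁), hab, zpow_one]
end

section
/- Correctness of the meta-reduction's Diffie–Hellman test against Damgård–Pedersen undeniable signatures: Let G be a group, α, s ∈ G, and ν, a, b, ρ natural numbers; set β = α^ν. The component-wise product of the ElGamal ciphertext (α^ρ, s * β^ρ) of s with the pair (α^a, β^b) is again an ElGamal ciphertext of s under the key (α, β) — that is, there exists an exponent ρ' with α^a * α^ρ = α^{ρ'} and s * (β^b * β^ρ) = s * β^{ρ'} — if and only if β^a = β^b (equivalently, iff (α, β, α^a, β^b) is a Diffie–Hellman tuple, since β^a = (α^a)^ν). -/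
/-- Correctness of the meta-reduction's Diffie–Hellman test against
Damgård–Pedersen undeniable signatures: the componentwise product of the
ElGamal ciphertext `(α ^ ρ, s * β ^ ρ)` of `s` with `(α ^ a, β ^ b)` is again
an ElGamal ciphertext of `s` under the key `(α, β)` iff `β ^ a = β ^ b`. -/
theorem ddh_test_correctness
    {G : Type*} [Group G] (α s : G) (ν a b ρ : ℕ) (β : G) (hβ : β = α ^ ν) :
    (∃ ρ' : ℕ, α ^ a * α ^ ρ = α ^ ρ' ∧ s * (β ^ b * β ^ ρ) = s * β ^ ρ') ↔
      β ^ a = β ^ b := by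
  subst hβ
  constructor
  · rintro ⟨ρ', h₁, h₂⟩
    have h₃ : (α ^ ν) ^ b * (α ^ ν) ^ ρ = (α ^ ν) ^ ρ' := mul_left_cancel h₂
    refine mul_right_cancel (b := (α ^ ν) ^ ρ) ?_
    rw [h₃, ← pow_add, pow_right_comm, pow_add, h₁, pow_right_comm]
  · intro h
    exact ⟨a + ρ, (pow_add α a ρ).symm, by rw [← h, pow_add]⟩
end

section
/- Perfect honest-verifier zero-knowledge of the combined confirmation protocol (zero-knowledge part of the theorem that the confirmation protocol of Figure 6 is a zero-knowledge proof of knowledge): Let G be a finite group, H and C groups, f : G →* H and E : G →* C group homomorphisms, s ∈ G and b a natural number. Then the distribution of the honest prover's transcript components (t₁, t₂, z) = (f(s'), E(s'), s' * s^b), when s' is drawn uniformly at random from G, equals the distribution of the simulated transcript (f(z) * (f(s)^b)⁻¹, E(z) * (E(s)^b)⁻¹, z), when z is drawn uniformly at random from G. Formally, PMF.map (fun s' => (f s', E s', s' * s^b)) of the uniform distribution on G equals PMF.map (fun z => (f z * (f s ^ b)⁻¹, E z * (E s ^ b)⁻¹, z)) of the uniform distribution on G. -/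
/-- Perfect honest-verifier zero-knowledge of the combined confirmation protocol:
the real transcript `(f s', E s', s' * s ^ b)` with `s'` uniform on `G` has the
same distribution as the simulated transcript
`(f z * (f s ^ b)⁻¹, E z * (E s ^ b)⁻¹, z)` with `z` uniform on `G`. -/
theorem perfect_hvzk_combined_confirmation
    {G H C : Type*} [Group G] [Fintype G] [Nonempty G] [Group H] [Group C]
    (f : G →* H) (E : G →* C) (s : G) (b : ℕ) :
    PMF.map (fun s' => (f s', E s', s' * s ^ b)) (PMF.uniformOfFintype G) =
      PMF.map (fun z => (f z * (f s ^ b)⁻¹, E z * (E s ^ b)⁻¹, z))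
        (PMF.uniformOfFintype G) := by
  conv_rhs => rw [← PMF.map_equiv_uniformOfFintype (Equiv.mulRight (s ^ b))]
  rw [PMF.map_comp]
  congr 1
  ext x <;> simp
end
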